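/- arXiv:2406.17098 — 2 statements merged into one kernel-verified Lean document; each statement's English description precedes it below -/
import Mathlib

section
/- Let P be a row-stochastic matrix on a finite nonempty state space S and γ ∈ (0,1), and assume occ γ P s g > 0 for all s, g ∈ S (e.g., the chain is irreducible). Define d : S → S → ℝ by d s g = Real.log (occ γ P g g) − Real.log (occ γ P s g). Then d is a quasimetric on S: (i) d s g ≥ 0 for all s, g; (ii) d s g = 0 if and only if s = g; (iii) d s g ≤ d s w + d w g for all s, w, g. (Paper's Corollary 4.8: the successor distance of an uncontrolled Markov process is a quasimetric.) -/
open scoped BigOperators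

variable {S : Type*} [Fintype S] [DecidableEq S] [Nonempty S]

/-- `P` is a row-stochastic matrix. -/
def IsStochastic (P : Matrix S S ℝ) : Prop :=
  (∀ s s', 0 ≤ P s s') ∧ ∀ s, ∑ s', P s s' = 1

/-- Discounted state occupancy measure `occ γ P s g = (1-γ) Σ_t γ^t (P^t) s g`. -/
noncomputable def occ (γ : ℝ) (P : Matrix S S ℝ) (s g : S) : ℝ :=
  (1 - γ) * ∑' t : ℕ, γ ^ t * (P ^ t) s g

/-- First-passage (hitting-time) probabilities of a Markov chain. -/
noncomputable def fp {X : Type*} [Fintype X] [DecidableEq X] (M : Matrix X X ℝ) :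
    ℕ → X → X → ℝ
  | 0, x, y => if x = y then 1 else 0
  | h + 1, x, y => if x = y then 0 else ∑ x' : X, M x x' * fp M h x' y

/-- Laplace transform of the hitting time: `L γ M x y = Σ_h γ^h f h x y`. -/
noncomputable def Lhit {X : Type*} [Fintype X] [DecidableEq X]
    (γ : ℝ) (M : Matrix X X ℝ) (x y : X) : ℝ :=
  ∑' h : ℕ, γ ^ h * fp M h x y

/-- Successor distance of an uncontrolled Markov process. -/
noncomputable def dSD (γ : ℝ) (P : Matrix S S ℝ) (s g : S) : ℝ :=
  Real.log (occ γ P g g) - Real.log (occ γ P s g)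

theorem aux_pow (P : Matrix S S ℝ) (hP : IsStochastic P) (t : ℕ) :
    (∀ s g, 0 ≤ (P ^ t) s g) ∧ ∀ s g, (P ^ t) s g ≤ 1 := by
  induction t with
  | zero =>
    constructor <;> intro s g <;> rw [pow_zero, Matrix.one_apply] <;> split_ifs <;> norm_num
  | succ t ih =>
    constructor
    · intro s g
      rw [pow_succ', Matrix.mul_apply]
      exact Finset.sum_nonneg fun x _ => mul_nonneg (hP.1 _ _) (ih.1 _ _)
    · intro s g
      rw [pow_succ', Matrix.mul_apply, ← hP.2 s]
      exact Finset.sum_le_sum fun x _ => mul_le_of_le_one_right (hP.1 _ _) (ih.2 _ _)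

theorem aux_summable (γ : ℝ) (hγ0 : 0 < γ) (hγ1 : γ < 1)
    (P : Matrix S S ℝ) (hP : IsStochastic P) (s g : S) :
    Summable fun t : ℕ => γ ^ t * (P ^ t) s g := by
  refine Summable.of_nonneg_of_le (fun t => ?_) (fun t => ?_)
    (summable_geometric_of_lt_one hγ0.le hγ1)
  · exact mul_nonneg (pow_nonneg hγ0.le t) ((aux_pow P hP t).1 s g)
  · exact mul_le_of_le_one_right (pow_nonneg hγ0.le t) ((aux_pow P hP t).2 s g)

theorem aux_rec (γ : ℝ) (hγ0 : 0 < γ) (hγ1 : γ < 1)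
    (P : Matrix S S ℝ) (hP : IsStochastic P) (s g : S) :
    occ γ P s g = (1 - γ) * (if s = g then 1 else 0) + γ * ∑ x, P s x * occ γ P x g := by
  have h1 : ∑' t : ℕ, γ ^ (t + 1) * (P ^ (t + 1)) s g
      = γ * ∑ x, P s x * ∑' t : ℕ, γ ^ t * (P ^ t) x g := by
    simp_rw [← tsum_mul_left]
    rw [← Summable.tsum_finsetSum
      (fun x _ => (aux_summable γ hγ0 hγ1 P hP x g).mul_left (P s x)), ← tsum_mul_left]
    congr 1
    funext t
    rw [pow_succ' P, Matrix.mul_apply, Finset.mul_sum, Finset.mul_sum]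
    refine Finset.sum_congr rfl fun x _ => ?_
    ring
  unfold occ
  rw [(aux_summable γ hγ0 hγ1 P hP s g).tsum_eq_zero_add, h1, pow_zero, pow_zero,
    Matrix.one_apply, mul_add, one_mul]
  congr 1
  rw [mul_left_comm, Finset.mul_sum]
  congr 1
  refine Finset.sum_congr rfl fun x _ => ?_
  ring

theorem aux_min (γ : ℝ) (hγ0 : 0 < γ) (hγ1 : γ < 1)
    (P : Matrix S S ℝ) (hP : IsStochastic P) (h : S → ℝ)
    (hh : ∀ s, 0 ≤ h s ∨ γ * ∑ x, P s x * h x ≤ h s) (s : S) : 0 ≤ h s := by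
  obtain ⟨m, hm⟩ := Finite.exists_min h
  refine le_trans ?_ (hm s)
  rcases hh m with h0 | h0
  · exact h0
  · have : h m ≤ ∑ x, P m x * h x := by
      calc h m = ∑ x, P m x * h m := by rw [← Finset.sum_mul, hP.2, one_mul]
        _ ≤ _ := Finset.sum_le_sum fun x _ => mul_le_mul_of_nonneg_left (hm x) (hP.1 _ _)
    nlinarith

theorem aux_tri (γ : ℝ) (hγ0 : 0 < γ) (hγ1 : γ < 1)
    (P : Matrix S S ℝ) (hP : IsStochastic P)
    (hpos : ∀ s g : S, 0 < occ γ P s g) (s w g : S) :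
    occ γ P s w * occ γ P w g ≤ occ γ P w w * occ γ P s g := by
  have := aux_min γ hγ0 hγ1 P hP
    (fun s => occ γ P w w * occ γ P s g - occ γ P w g * occ γ P s w) ?_ s
  · skip
    linarith
  intro s
  by_cases hs : s = w
  · left
    subst hs
    linarith
  · right
    have e1 := aux_rec γ hγ0 hγ1 P hP s g
    have e2 := aux_rec γ hγ0 hγ1 P hP s w
    rw [if_neg hs] at e2
    have e3 : ∑ x, P s x * (occ γ P w w * occ γ P x g - occ γ P w g * occ γ P x w)
        = occ γ P w w * ∑ x, P s x * occ γ P x g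
          - occ γ P w g * ∑ x, P s x * occ γ P x w := by
      rw [Finset.mul_sum, Finset.mul_sum, ← Finset.sum_sub_distrib]
      refine Finset.sum_congr rfl fun x _ => ?_
      ring
    rw [e3, e1, e2]
    have : 0 ≤ occ γ P w w * ((1 - γ) * (if s = g then 1 else 0)) := by
      refine mul_nonneg (hpos _ _).le (mul_nonneg (by linarith) ?_)
      split_ifs <;> norm_num
    linarith

theorem aux_lt (γ : ℝ) (hγ0 : 0 < γ) (hγ1 : γ < 1)
    (P : Matrix S S ℝ) (hP : IsStochastic P)
    (hpos : ∀ s g : S, 0 < occ γ P s g) (s g : S) (hsg : s ≠ g) :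
    occ γ P s g < occ γ P g g := by
  obtain ⟨m, hm⟩ := Finite.exists_max (fun x => occ γ P x g)
  have key : ∀ s, s ≠ g → occ γ P s g ≤ γ * occ γ P m g := by
    intro s hs
    rw [aux_rec γ hγ0 hγ1 P hP s g, if_neg hs, mul_zero, zero_add]
    refine mul_le_mul_of_nonneg_left ?_ hγ0.le
    calc ∑ x, P s x * occ γ P x g ≤ ∑ x, P s x * occ γ P m g :=
          Finset.sum_le_sum fun x _ => mul_le_mul_of_nonneg_left (hm x) (hP.1 _ _)
      _ = _ := by rw [← Finset.sum_mul, hP.2, one_mul]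
  have hmg : m = g := by
    by_contra hne
    have := key m hne
    nlinarith [hpos m g]
  have := key s hsg
  rw [hmg] at this
  nlinarith [hpos g g]

/-- The successor distance is a quasimetric: positivity, identity, and the
triangle inequality. -/
theorem dSD_quasimetric (γ : ℝ) (hγ0 : 0 < γ) (hγ1 : γ < 1)
    (P : Matrix S S ℝ) (hP : IsStochastic P)
    (hpos : ∀ s g : S, 0 < occ γ P s g) :
    (∀ s g : S, 0 ≤ dSD γ P s g) ∧
      (∀ s g : S, dSD γ P s g = 0 ↔ s = g) ∧
      (∀ s w g : S, dSD γ P s g ≤ dSD γ P s w + dSD γ P w g) := by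
  refine ⟨fun s g => ?_, fun s g => ⟨fun h => ?_, fun h => ?_⟩, fun s w g => ?_⟩
  · unfold dSD
    by_cases hs : s = g
    · simp [hs]
    · have := Real.log_lt_log (hpos s g) (aux_lt γ hγ0 hγ1 P hP hpos s g hs)
      linarith
  · by_contra hs
    unfold dSD at h
    have := Real.log_lt_log (hpos s g) (aux_lt γ hγ0 hγ1 P hP hpos s g hs)
    linarith
  · simp [dSD, h]
  · have := Real.log_le_log (mul_pos (hpos s w) (hpos w g))
      (aux_tri γ hγ0 hγ1 P hP hpos s w g)
    rw [Real.log_mul (hpos _ _).ne' (hpos _ _).ne',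
      Real.log_mul (hpos _ _).ne' (hpos _ _).ne'] at this
    unfold dSD
    linarith
end

section
/- Consider a controlled Markov process with finite nonempty state space S, finite nonempty action space A, row-stochastic dynamics P : S → A → S → ℝ, and discount γ ∈ (0,1). Then for all states s, w, g ∈ S and actions a_s, a_w, a_g ∈ A, the state-action waypoint inequality holds: ⨆_{π' ∈ Π} [ occSA γ π' (w,a_w) (g,a_g) · occSA γ π' (s,a_s) (w,a_w) / occSA γ π' (w,a_w) (w,a_w) ] ≤ ⨆_{π' ∈ Π} occSA γ π' (s,a_s) (g,a_g). (Paper's Lemma D.1.) -/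
open scoped BigOperators

variable {S A : Type*} [Fintype S] [DecidableEq S] [Nonempty S]
  [Fintype A] [DecidableEq A] [Nonempty A]

/-- Row-stochastic controlled dynamics. -/
def IsDynamics (P : S → A → S → ℝ) : Prop :=
  (∀ s a s', 0 ≤ P s a s') ∧ ∀ s a, ∑ s', P s a s' = 1

/-- Stationary stochastic policy. -/
def IsPolicy (π : S → A → ℝ) : Prop :=
  (∀ s a, 0 ≤ π s a) ∧ ∀ s, ∑ a, π s a = 1

/-- The set of stationary stochastic policies, as a subtype. -/
abbrev Pol (S A : Type*) [Fintype A] : Type _ := {π : S → A → ℝ // IsPolicy π}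

/-- State-transition matrix induced by policy `π`. -/
noncomputable def Pmat (P : S → A → S → ℝ) (π : S → A → ℝ) : Matrix S S ℝ :=
  fun s s' => ∑ a, π s a * P s a s'

/-- Discounted state occupancy measure under policy `π`. -/
noncomputable def occC (γ : ℝ) (P : S → A → S → ℝ) (π : S → A → ℝ) (s g : S) : ℝ :=
  (1 - γ) * ∑' t : ℕ, γ ^ t * ((Pmat P π) ^ t) s g

/-- State-action transition matrix on `S × A` induced by policy `π`. -/
noncomputable def Qmat (P : S → A → S → ℝ) (π : S → A → ℝ) :
    Matrix (S × A) (S × A) ℝ :=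
  fun x y => P x.1 x.2 y.1 * π y.1 y.2

/-- Discounted state-action occupancy measure under policy `π`. -/
noncomputable def occSA (γ : ℝ) (P : S → A → S → ℝ) (π : S → A → ℝ)
    (x y : S × A) : ℝ :=
  (1 - γ) * ∑' t : ℕ, γ ^ t * ((Qmat P π) ^ t) x y

section helpers

variable {X : Type*} [Fintype X] [DecidableEq X]

theorem aux_pow_nonneg (Q : Matrix X X ℝ) (h0 : ∀ x y, 0 ≤ Q x y) (t : ℕ) :
    ∀ x y, 0 ≤ (Q ^ t) x y := by
  induction t with
  | zero =>
    intro x y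
    rw [pow_zero, Matrix.one_apply]
    split_ifs <;> norm_num
  | succ k ih =>
    intro x y
    rw [pow_succ, Matrix.mul_apply]
    exact Finset.sum_nonneg fun z _ => mul_nonneg (ih x z) (h0 z y)

theorem aux_pow_sum (Q : Matrix X X ℝ) (h1 : ∀ x, ∑ y, Q x y = 1) (t : ℕ) :
    ∀ x, ∑ y, (Q ^ t) x y = 1 := by
  induction t with
  | zero =>
    intro x
    simp [Matrix.one_apply]
  | succ k ih =>
    intro x
    simp_rw [pow_succ, Matrix.mul_apply]
    rw [Finset.sum_comm]
    simp_rw [← Finset.mul_sum, h1, mul_one]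
    exact ih x

theorem aux_pow_le_one (Q : Matrix X X ℝ) (h0 : ∀ x y, 0 ≤ Q x y)
    (h1 : ∀ x, ∑ y, Q x y = 1) (t : ℕ) (x y : X) : (Q ^ t) x y ≤ 1 := by
  rw [← aux_pow_sum Q h1 t x]
  exact Finset.single_le_sum (f := fun y => (Q ^ t) x y)
    (fun z _ => aux_pow_nonneg Q h0 t x z) (Finset.mem_univ y)

theorem aux_summable_s17 (γ : ℝ) (hγ0 : 0 < γ) (hγ1 : γ < 1) (Q : Matrix X X ℝ)
    (h0 : ∀ x y, 0 ≤ Q x y) (h1 : ∀ x, ∑ y, Q x y = 1) (x y : X) :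
    Summable fun t : ℕ => γ ^ t * (Q ^ t) x y := by
  refine Summable.of_nonneg_of_le
    (fun t => mul_nonneg (pow_nonneg hγ0.le t) (aux_pow_nonneg Q h0 t x y)) (fun t => ?_)
    (summable_geometric_of_lt_one hγ0.le hγ1)
  exact mul_le_of_le_one_right (pow_nonneg hγ0.le t) (aux_pow_le_one Q h0 h1 t x y)

theorem aux_rec_s17 (γ : ℝ) (hγ0 : 0 < γ) (hγ1 : γ < 1) (Q : Matrix X X ℝ)
    (h0 : ∀ x y, 0 ≤ Q x y) (h1 : ∀ x, ∑ y, Q x y = 1) (x y : X) :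
    (∑' t : ℕ, γ ^ t * (Q ^ t) x y) =
      (if x = y then 1 else 0) + γ * ∑ z, Q x z * ∑' t : ℕ, γ ^ t * (Q ^ t) z y := by
  rw [(aux_summable_s17 γ hγ0 hγ1 Q h0 h1 x y).tsum_eq_zero_add]
  congr 1
  · simp [Matrix.one_apply]
  · simp_rw [← tsum_mul_left]
    rw [← Summable.tsum_finsetSum
      (fun z _ => (aux_summable_s17 γ hγ0 hγ1 Q h0 h1 z y).mul_left _), ← tsum_mul_left]
    congr 1
    funext t
    rw [pow_succ' Q, Matrix.mul_apply, Finset.mul_sum, Finset.mul_sum]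
    refine Finset.sum_congr rfl fun z _ => ?_
    ring

theorem aux_main (γ : ℝ) (hγ0 : 0 < γ) (hγ1 : γ < 1) (Q : Matrix X X ℝ)
    (h0 : ∀ x y, 0 ≤ Q x y) (h1 : ∀ x, ∑ y, Q x y = 1) (G : X → X → ℝ)
    (hG0 : ∀ x y, 0 ≤ G x y)
    (hG : ∀ x y, G x y = (if x = y then 1 else 0) + γ * ∑ z, Q x z * G z y)
    (x w g : X) : G w g * G x w ≤ G x g * G w w := by
  obtain ⟨m, -, hm⟩ := Finset.exists_min_image Finset.univ
    (fun x => G x g * G w w - G x w * G w g) ⟨x, Finset.mem_univ x⟩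
  have hx := hm x (Finset.mem_univ x)
  suffices h : 0 ≤ G m g * G w w - G m w * G w g by
    have := h.trans hx
    linarith
  by_contra hneg
  push Not at hneg
  have hmw : m ≠ w := by
    rintro rfl
    apply hneg.ne
    ring
  have key : G m g * G w w - G m w * G w g =
      (if m = g then 1 else 0) * G w w
        + γ * ∑ z, Q m z * (G z g * G w w - G z w * G w g) := by
    have e : ∑ z, Q m z * (G z g * G w w - G z w * G w g) =
        (∑ z, Q m z * G z g) * G w w - (∑ z, Q m z * G z w) * G w g := by
      rw [Finset.sum_mul, Finset.sum_mul, ← Finset.sum_sub_distrib]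
      refine Finset.sum_congr rfl fun z _ => ?_
      ring
    have e1 := hG m g
    have e2 := hG m w
    rw [if_neg hmw] at e2
    rw [e]
    linear_combination G w w * e1 - G w g * e2
  have hsum : G m g * G w w - G m w * G w g ≤
      ∑ z, Q m z * (G z g * G w w - G z w * G w g) := by
    calc _ = ∑ z, Q m z * (G m g * G w w - G m w * G w g) := by
          rw [← Finset.sum_mul, h1, one_mul]
      _ ≤ _ := Finset.sum_le_sum fun z _ =>
          mul_le_mul_of_nonneg_left (hm z (Finset.mem_univ z)) (h0 m z)
  have hd : 0 ≤ (if m = g then (1 : ℝ) else 0) * G w w := by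
    apply mul_nonneg _ (hG0 w w)
    split_ifs <;> norm_num
  have := mul_le_mul_of_nonneg_left hsum hγ0.le
  nlinarith

end helpers

theorem aux_Q_nonneg {S A : Type*} [Fintype S] [Fintype A] (P : S → A → S → ℝ)
    (hP : IsDynamics P) (π : S → A → ℝ) (hπ : IsPolicy π) (x y : S × A) :
    0 ≤ Qmat P π x y :=
  mul_nonneg (hP.1 _ _ _) (hπ.1 _ _)

theorem aux_Q_sum {S A : Type*} [Fintype S] [Fintype A] (P : S → A → S → ℝ)
    (hP : IsDynamics P) (π : S → A → ℝ) (hπ : IsPolicy π) (x : S × A) :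
    ∑ y, Qmat P π x y = 1 := by
  simp only [Qmat, Fintype.sum_prod_type]
  simp_rw [← Finset.mul_sum, hπ.2, mul_one]
  exact hP.2 _ _

/-- State-action waypoint inequality (Lemma D.1). -/
theorem occSA_waypoint_inequality (γ : ℝ) (hγ0 : 0 < γ) (hγ1 : γ < 1)
    (P : S → A → S → ℝ) (hP : IsDynamics P)
    (s w g : S) (a_s a_w a_g : A) :
    (⨆ π' : Pol S A,
        occSA γ P π'.1 (w, a_w) (g, a_g) * occSA γ P π'.1 (s, a_s) (w, a_w) /
          occSA γ P π'.1 (w, a_w) (w, a_w)) ≤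
      ⨆ π' : Pol S A, occSA γ P π'.1 (s, a_s) (g, a_g) := by
  have hN := fun π' : Pol S A => aux_Q_nonneg P hP π'.1 π'.2
  have hS := fun π' : Pol S A => aux_Q_sum P hP π'.1 π'.2
  have h1γ : 0 < 1 - γ := sub_pos.2 hγ1
  apply ciSup_mono
  · refine ⟨1, ?_⟩
    rintro _ ⟨π', rfl⟩
    have h : (∑' t : ℕ, γ ^ t * ((Qmat P π'.1) ^ t) (s, a_s) (g, a_g)) ≤ (1 - γ)⁻¹ := by
      rw [← tsum_geometric_of_lt_one hγ0.le hγ1]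
      refine Summable.tsum_le_tsum (fun t => ?_)
        (aux_summable_s17 γ hγ0 hγ1 _ (hN π') (hS π') _ _)
        (summable_geometric_of_lt_one hγ0.le hγ1)
      exact mul_le_of_le_one_right (pow_nonneg hγ0.le t)
        (aux_pow_le_one _ (hN π') (hS π') t _ _)
    calc occSA γ P π'.1 (s, a_s) (g, a_g) ≤ (1 - γ) * (1 - γ)⁻¹ :=
          mul_le_mul_of_nonneg_left h h1γ.le
      _ = 1 := mul_inv_cancel₀ h1γ.ne'
  · intro π'
    have hG0 : ∀ x y, 0 ≤ ∑' t : ℕ, γ ^ t * ((Qmat P π'.1) ^ t) x y := fun x y =>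
      tsum_nonneg fun t => mul_nonneg (pow_nonneg hγ0.le t) (aux_pow_nonneg _ (hN π') t x y)
    have hm := aux_main γ hγ0 hγ1 (Qmat P π'.1) (hN π') (hS π')
      (fun x y => ∑' t : ℕ, γ ^ t * ((Qmat P π'.1) ^ t) x y) hG0
      (aux_rec_s17 γ hγ0 hγ1 _ (hN π') (hS π')) (s, a_s) (w, a_w) (g, a_g)
    refine div_le_of_le_mul₀ (mul_nonneg h1γ.le (hG0 _ _)) (mul_nonneg h1γ.le (hG0 _ _)) ?_
    have := mul_le_mul_of_nonneg_left hm (mul_self_nonneg (1 - γ))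
    simp only [occSA]
    linarith
end
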